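/- Let 𝒜 be an f-algebra with a multiplicative unit e, and suppose there exists a submultiplicative Riesz norm on 𝒜, i.e. a norm with |a| ≤ |b| ⇒ ‖a‖ ≤ ‖b‖ and ‖a·b‖ ≤ ‖a‖·‖b‖ for all a, b ≥ 0. Then the multiplicative unit e is an order unit in 𝒜, and Φ₁(𝒜) = Φ₂(𝒜) = Φ₃(𝒜) = 𝒜. -/

import Mathlib

namespace FiniteElementsPaper

/-- Product of `p` factors `φ 0 * φ 1 * ⋯ * φ (p-1)` in a (possibly non-unital)
multiplicative structure; junk value `0` when `p = 0`. -/
def mulProd {A : Type*} [Mul A] [Zero A] : (p : ℕ) → (Fin p → A) → A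
  | 0, _ => 0
  | q + 1, φ => Fin.foldl q (fun acc i => acc * φ i.succ) (φ 0)

/-- `p`-th power `a^p` (junk value `0` for `p = 0`). -/
def mpow {A : Type*} [Mul A] [Zero A] (a : A) (p : ℕ) : A :=
  mulProd p (fun _ => a)

/-- The set `Π_p(𝒜)` of all `p`-fold products. -/
def piSet (A : Type*) [Mul A] [Zero A] (p : ℕ) : Set A :=
  {x | ∃ φ : Fin p → A, x = mulProd p φ}

variable {A : Type*} [Lattice A] [AddCommGroup A] [Module ℝ A]

/-- `z` is a majorant of `φ`: `z ≥ 0` and for every `x` there is `c > 0` with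
`|x| ⊓ n • |φ| ≤ c • z` for all `n`. -/
def IsMajorant (z φ : A) : Prop :=
  0 ≤ z ∧ ∀ x : A, ∃ c : ℝ, 0 < c ∧ ∀ n : ℕ, |x| ⊓ n • |φ| ≤ c • z

/-- `φ` is a finite element. -/
def IsFiniteElt (φ : A) : Prop := ∃ z : A, IsMajorant z φ

/-- `φ` is a totally finite element: it has a majorant which is itself finite. -/
def IsTotallyFiniteElt (φ : A) : Prop := ∃ z : A, IsMajorant z φ ∧ IsFiniteElt z

/-- `φ` is self-majorizing: `|φ|` is a majorant of `φ`. -/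
def IsSelfMajorizing (φ : A) : Prop := IsMajorant |φ| φ

/-- `φ ∈ Φ₃(A) = S₊(A) - S₊(A)`. -/
def InPhi3 (φ : A) : Prop :=
  ∃ s t : A, 0 ≤ s ∧ 0 ≤ t ∧ IsSelfMajorizing s ∧ IsSelfMajorizing t ∧ φ = s - t

/-- `w` is a majorant of `φ` relative to the subset `S` (all lattice operations
computed in the ambient algebra). -/
def IsMajorantIn (S : Set A) (w φ : A) : Prop :=
  0 ≤ w ∧ ∀ x ∈ S, ∃ c : ℝ, 0 < c ∧ ∀ n : ℕ, |x| ⊓ n • |φ| ≤ c • w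

/-- `φ` is a finite element of the sublattice `S` (majorant required to lie in `S`). -/
def IsFiniteEltIn (S : Set A) (φ : A) : Prop := ∃ w ∈ S, IsMajorantIn S w φ

/-- `φ` is a totally finite element of the sublattice `S`. -/
def IsTotallyFiniteEltIn (S : Set A) (φ : A) : Prop :=
  ∃ w ∈ S, IsMajorantIn S w φ ∧ IsFiniteEltIn S w

/-- `φ` is self-majorizing in the sublattice `S`. -/
def IsSelfMajorizingIn (S : Set A) (φ : A) : Prop := IsMajorantIn S |φ| φ

/-- `φ ∈ Φ₃(S) = S₊(S) - S₊(S)` for the sublattice `S`. -/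
def InPhi3In (S : Set A) (φ : A) : Prop :=
  ∃ s t : A, s ∈ S ∧ t ∈ S ∧ 0 ≤ s ∧ 0 ≤ t ∧
    IsSelfMajorizingIn S s ∧ IsSelfMajorizingIn S t ∧ φ = s - t

variable (A) in
/-- Archimedean ℓ-algebra structure: an Archimedean vector lattice together with an
associative bilinear multiplication whose product of positive elements is positive. -/
structure IsLAlgebra [Mul A] : Prop where
  add_le_add_left : ∀ a b : A, a ≤ b → ∀ c : A, c + a ≤ c + b
  smul_le_smul : ∀ (r : ℝ) (a b : A), 0 ≤ r → a ≤ b → r • a ≤ r • b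
  archimedean : ∀ a b : A, 0 ≤ a → (∀ n : ℕ, n • a ≤ b) → a = 0
  mul_assoc : ∀ a b c : A, a * b * c = a * (b * c)
  left_distrib : ∀ a b c : A, a * (b + c) = a * b + a * c
  right_distrib : ∀ a b c : A, (a + b) * c = a * c + b * c
  smul_mul : ∀ (r : ℝ) (a b : A), (r • a) * b = r • (a * b)
  mul_smul : ∀ (r : ℝ) (a b : A), a * (r • b) = r • (a * b)
  mul_nonneg : ∀ a b : A, 0 ≤ a → 0 ≤ b → 0 ≤ a * b

variable (A) in
/-- A `d`-algebra: ℓ-algebra in which `a ⊓ b = 0` implies `(a*c) ⊓ (b*c) = (c*a) ⊓ (c*b) = 0`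
for all `c ≥ 0`. -/
structure IsDAlgebra [Mul A] extends IsLAlgebra A : Prop where
  d_prop : ∀ a b c : A, a ⊓ b = 0 → 0 ≤ c → (a * c) ⊓ (b * c) = 0 ∧ (c * a) ⊓ (c * b) = 0

variable (A) in
/-- An `f`-algebra: ℓ-algebra in which `a ⊓ b = 0` implies `(a*c) ⊓ b = (c*a) ⊓ b = 0`
for all `c ≥ 0`. -/
structure IsFAlgebra [Mul A] extends IsLAlgebra A : Prop where
  f_prop : ∀ a b c : A, a ⊓ b = 0 → 0 ≤ c → (a * c) ⊓ b = 0 ∧ (c * a) ⊓ b = 0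

/-- `e` is a multiplicative unit. -/
def IsMulUnit [Mul A] (e : A) : Prop := ∀ a : A, a * e = a ∧ e * a = a

/-- `e` is an order unit. -/
def IsOrderUnit (e : A) : Prop := 0 ≤ e ∧ ∀ x : A, ∃ l : ℝ, 0 ≤ l ∧ |x| ≤ l • e

variable (A) in
/-- The algebra is semiprime: `0` is its only nilpotent element. -/
def IsSemiprime [Mul A] [Zero A] : Prop :=
  ∀ (a : A) (n : ℕ), 0 < n → mpow a n = 0 → a = 0

variable (A) in
/-- The vector lattice is uniformly complete. -/
def UniformlyComplete : Prop :=
  ∀ u : A, 0 ≤ u → ∀ f : ℕ → A,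
    (∀ ε : ℝ, 0 < ε → ∃ K : ℕ, ∀ m n : ℕ, K ≤ m → K ≤ n → |f m - f n| ≤ ε • u) →
    ∃ a : A, ∀ ε : ℝ, 0 < ε → ∃ K : ℕ, ∀ n : ℕ, K ≤ n → |f n - a| ≤ ε • u

variable (A) in
/-- The weak factorization property: every element is dominated by a product. -/
def WeakFactorization [Mul A] : Prop := ∀ a : A, ∃ b c : A, a ≤ b * c


theorem IsLAlgebra.isOrderedAddMonoid {A : Type*} [Lattice A] [AddCommGroup A] [Module ℝ A]
    [Mul A] (hA : IsLAlgebra A) : IsOrderedAddMonoid A where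
  add_le_add_left a b h c := by
    simpa only [add_comm _ c] using hA.add_le_add_left a b h c

/-- Disjoint elements of an f-algebra have product zero. -/
theorem IsFAlgebra.mul_eq_zero_of_inf_eq_zero {A : Type*} [Lattice A] [AddCommGroup A]
    [Module ℝ A] [Mul A] (hA : IsFAlgebra A) {a b : A} (hab : a ⊓ b = 0) : a * b = 0 := by
  have ha : 0 ≤ a := hab ▸ inf_le_left
  have hb : 0 ≤ b := hab ▸ inf_le_right
  have h := (hA.f_prop a b b hab hb).1
  rw [inf_comm] at h
  simpa using (hA.f_prop b (a * b) a h ha).2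

/-- The multiplicative unit of an f-algebra is positive. -/
theorem IsFAlgebra.mulUnit_nonneg {A : Type*} [Lattice A] [AddCommGroup A]
    [Module ℝ A] [Mul A] (hA : IsFAlgebra A) {e : A} (hunit : IsMulUnit e) : 0 ≤ e := by
  have := hA.toIsLAlgebra.isOrderedAddMonoid
  have hdisj : e⁺ * e⁻ = 0 := hA.mul_eq_zero_of_inf_eq_zero (posPart_inf_negPart_eq_zero e)
  have hsplit : e + e⁻ = e⁺ := by
    nth_rewrite 1 [← posPart_sub_negPart e]
    exact sub_add_cancel _ _
  have h := hA.right_distrib e e⁻ e⁻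
  rw [hsplit, hdisj, (hunit _).2] at h
  have hle : e⁻ ≤ 0 :=
    h ▸ le_add_of_nonneg_right (hA.mul_nonneg _ _ (negPart_nonneg e) (negPart_nonneg e))
  exact negPart_eq_zero.mp (le_antisymm hle (negPart_nonneg e))

/-- An element of a unital f-algebra is dominated by every multiple of the unit whose
coefficient strictly exceeds a submultiplicative Riesz norm of that element. -/
theorem IsFAlgebra.le_smul_mulUnit {A : Type*} [Lattice A] [AddCommGroup A]
    [Module ℝ A] [Mul A] (hA : IsFAlgebra A) {e : A} (hunit : IsMulUnit e)
    {N : A → ℝ} (hN0 : ∀ x : A, N x = 0 ↔ x = 0)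
    (hNsmul : ∀ (r : ℝ) (x : A), N (r • x) = |r| * N x)
    (hNriesz : ∀ x y : A, |x| ≤ |y| → N x ≤ N y)
    (hNsubmul : ∀ x y : A, 0 ≤ x → 0 ≤ y → N (x * y) ≤ N x * N y)
    {a : A} (ha : 0 ≤ a) {r : ℝ} (hr : N a < r) : a ≤ r • e := by
  have := hA.toIsLAlgebra.isOrderedAddMonoid
  have hN_nonneg : ∀ x : A, 0 ≤ N x := fun x => by
    have h := hNriesz 0 x (by simp)
    rwa [(hN0 0).2 rfl] at h
  have hr0 : 0 ≤ r := (hN_nonneg a).trans hr.le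
  set x : A := a - r • e with hx
  have hb : 0 ≤ x⁺ := posPart_nonneg x
  have hdisj : x⁻ * x⁺ = 0 :=
    hA.mul_eq_zero_of_inf_eq_zero (by rw [inf_comm, posPart_inf_negPart_eq_zero])
  have hxb : x * x⁺ = x⁺ * x⁺ := by
    have hsplit : x + x⁻ = x⁺ := by
      nth_rewrite 1 [← posPart_sub_negPart x]
      exact sub_add_cancel _ _
    have h := hA.right_distrib x x⁻ x⁺
    rw [hsplit, hdisj, add_zero] at h
    exact h.symm
  have hab : a * x⁺ = x⁺ * x⁺ + r • x⁺ := by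
    have h := hA.right_distrib x (r • e) x⁺
    rwa [hx, sub_add_cancel, ← hx, hxb, hA.smul_mul, (hunit _).2] at h
  have hle : r • x⁺ ≤ a * x⁺ :=
    hab ▸ le_add_of_nonneg_left (hA.mul_nonneg _ _ hb hb)
  have hrb : 0 ≤ r • x⁺ := by simpa using hA.smul_le_smul r 0 x⁺ hr0 hb
  have hNle : r * N x⁺ ≤ N a * N x⁺ := by
    have h := hNriesz (r • x⁺) (a * x⁺)
      (by rwa [abs_of_nonneg hrb, abs_of_nonneg (hrb.trans hle)])
    rw [hNsmul, abs_of_nonneg hr0] at h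
    exact h.trans (hNsubmul _ _ ha hb)
  have hNb : N x⁺ = 0 := by nlinarith [hN_nonneg x⁺]
  exact sub_nonpos.mp (posPart_eq_zero.mp ((hN0 _).1 hNb))

/-- Order units are majorants of every element. -/
theorem IsOrderUnit.isMajorant {A : Type*} [Lattice A] [AddCommGroup A] [Module ℝ A] [Mul A]
    (hA : IsLAlgebra A) {u : A} (hu : IsOrderUnit u) (a : A) : IsMajorant u a := by
  have := hA.isOrderedAddMonoid
  refine ⟨hu.1, fun x => ?_⟩
  obtain ⟨l, hl, hxl⟩ := hu.2 x
  refine ⟨l + 1, by linarith, fun n => inf_le_left.trans (hxl.trans ?_)⟩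
  rw [add_smul, one_smul]
  exact le_add_of_nonneg_right hu.1

/-- Elements above an order unit are order units. -/
theorem IsOrderUnit.mono {A : Type*} [Lattice A] [AddCommGroup A] [Module ℝ A] [Mul A]
    (hA : IsLAlgebra A) {u v : A} (hu : IsOrderUnit u) (huv : u ≤ v) : IsOrderUnit v := by
  refine ⟨hu.1.trans huv, fun x => ?_⟩
  obtain ⟨l, hl, hxl⟩ := hu.2 x
  exact ⟨l, hl, hxl.trans (hA.smul_le_smul l u v hl huv)⟩

/-- Positive order units are self-majorizing. -/
theorem IsOrderUnit.isSelfMajorizing {A : Type*} [Lattice A] [AddCommGroup A] [Module ℝ A]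
    [Mul A] (hA : IsLAlgebra A) {u : A} (hu : IsOrderUnit u) : IsSelfMajorizing u := by
  have := hA.isOrderedAddMonoid
  rw [IsSelfMajorizing, abs_of_nonneg hu.1]
  exact hu.isMajorant hA u

/-- In the presence of an order unit, every element is a difference of positive
self-majorizing elements. -/
theorem IsOrderUnit.inPhi3 {A : Type*} [Lattice A] [AddCommGroup A] [Module ℝ A]
    [Mul A] (hA : IsLAlgebra A) {u : A} (hu : IsOrderUnit u) (a : A) : InPhi3 a := by
  have := hA.isOrderedAddMonoid
  obtain ⟨l, hl, hal⟩ := hu.2 a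
  have hlu : 0 ≤ l • u := (abs_nonneg a).trans hal
  have ht : IsOrderUnit (l • u + u) := hu.mono hA (le_add_of_nonneg_left hlu)
  have hs : IsOrderUnit (a + (l • u + u)) := by
    refine hu.mono hA ?_
    rw [← add_assoc]
    refine le_add_of_nonneg_left ?_
    exact neg_le_iff_add_nonneg.mp (neg_le.mp ((neg_le_abs a).trans hal))
  exact ⟨_, _, hs.1, ht.1, hs.isSelfMajorizing hA, ht.isSelfMajorizing hA,
    (add_sub_cancel_right _ _).symm⟩

/-- An f-algebra with multiplicative unit `e` admitting a submultiplicative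
Riesz norm: `e` is an order unit and `Φ₁(𝒜) = Φ₂(𝒜) = Φ₃(𝒜) = 𝒜`. -/
theorem stmt5 {A : Type*} [Lattice A] [AddCommGroup A] [Module ℝ A] [Mul A]
    (hA : IsFAlgebra A) (e : A) (hunit : IsMulUnit e)
    (N : A → ℝ)
    (hN0 : ∀ x : A, N x = 0 ↔ x = 0)
    (hNsmul : ∀ (r : ℝ) (x : A), N (r • x) = |r| * N x)
    (hNadd : ∀ x y : A, N (x + y) ≤ N x + N y)
    (hNriesz : ∀ x y : A, |x| ≤ |y| → N x ≤ N y)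
    (hNsubmul : ∀ x y : A, 0 ≤ x → 0 ≤ y → N (x * y) ≤ N x * N y) :
    IsOrderUnit e ∧ ∀ a : A, IsFiniteElt a ∧ IsTotallyFiniteElt a ∧ InPhi3 a := by
  have hL := hA.toIsLAlgebra
  have := hL.isOrderedAddMonoid
  have he : IsOrderUnit e := by
    refine ⟨hA.mulUnit_nonneg hunit, fun x => ⟨max (N |x|) 0 + 1, by positivity, ?_⟩⟩
    exact hA.le_smul_mulUnit hunit hN0 hNsmul hNriesz hNsubmul (abs_nonneg x)
      (lt_of_le_of_lt (le_max_left _ _) (lt_add_one _))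
  exact ⟨he, fun a => ⟨⟨e, he.isMajorant hL a⟩, ⟨e, he.isMajorant hL a, e, he.isMajorant hL e⟩,
    he.inPhi3 hL a⟩⟩

end FiniteElementsPaper
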